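/- Let x₁,…,x_n ∈ ℝ^p, let η > 0, let H ∈ ℝ^{p×p} be a fixed matrix all of whose entries satisfy |H_{j,l}| ≤ 1/√(ηp), let D = diag(ε) with ε ∈ {−1,+1}^p having i.i.d. uniform random sign entries, and set y_i = H D x_i for i = 1,…,n. For each i, let w_i ∈ ℝ^p be obtained from y_i by keeping m of its p entries, chosen as a uniformly random m-element subset of the coordinates (independent of D), and setting the rest to zero. Then for every α ∈ (0,1), with probability at least 1 − α, simultaneously for all i = 1,…,n: ‖w_i‖₂² ≤ (m/p)·(2/η)·log(2np/α)·‖x_i‖₂². -/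

import Mathlib

open Matrix Finset

/-- Probability of event `A` under the uniform distribution on the finite type `Ω`. -/
noncomputable def probOf {Ω : Type*} [Fintype Ω] (A : Set Ω) : ℝ :=
  (A.ncard : ℝ) / Fintype.card Ω

/-- Expectation of `f` under the uniform distribution on the finite type `Ω`. -/
noncomputable def expec {Ω E : Type*} [Fintype Ω] [AddCommMonoid E] [Module ℝ E]
    (f : Ω → E) : E :=
  (Fintype.card Ω : ℝ)⁻¹ • ∑ ω, f ω

/-- Euclidean norm of a vector. -/
noncomputable def l2norm {ι : Type*} [Fintype ι] (v : ι → ℝ) : ℝ :=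
  Real.sqrt (∑ i, v i ^ 2)

/-- Random sign vector `ε ∈ {±1}^p` built from boolean coin flips. -/
def signVec {p : ℕ} (ω : Fin p → Bool) : Fin p → ℝ := fun i => if ω i then 1 else -1

/-- The diagonal random sign matrix `D = diag(ε)`. -/
noncomputable def signMatrix {p : ℕ} (ω : Fin p → Bool) : Matrix (Fin p) (Fin p) ℝ :=
  Matrix.diagonal (signVec ω)

/-- Sampling matrix `R ∈ ℝ^{p×m}` whose `j`-th column is the canonical basis vector `e_{σ j}`;
a uniformly random `σ : Fin m ↪ Fin p` models choosing `m` distinct canonical basis vectors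
uniformly at random without replacement. -/
noncomputable def sampMatrix {p m : ℕ} (σ : Fin m ↪ Fin p) : Matrix (Fin p) (Fin m) ℝ :=
  Matrix.of fun i j => if σ j = i then 1 else 0

/-- Spectral norm (ℓ²→ℓ² operator norm) of a square matrix. -/
noncomputable def specNorm {p : ℕ} (A : Matrix (Fin p) (Fin p) ℝ) : ℝ :=
  ‖LinearMap.toContinuousLinearMap (Matrix.toEuclideanLin A)‖

/-- `diag(A)`: the matrix obtained by zeroing all off-diagonal entries of `A`. -/
noncomputable def diagPart {p : ℕ} (A : Matrix (Fin p) (Fin p) ℝ) : Matrix (Fin p) (Fin p) ℝ :=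
  Matrix.diagonal A.diag

theorem aux_mgf {p : ℕ} (a : Fin p → ℝ) :
    ∑ ω : Fin p → Bool, Real.exp (∑ l, a l * signVec ω l) ≤
      2 ^ p * Real.exp ((∑ l, a l ^ 2) / 2) := by
  have h1 : ∑ ω : Fin p → Bool, Real.exp (∑ l, a l * signVec ω l)
      = ∏ l, ∑ b : Bool, Real.exp (a l * (if b then 1 else -1)) := by
    rw [Finset.prod_univ_sum]
    simp only [Fintype.piFinset_univ, signVec, Real.exp_sum]
  rw [h1]
  have h2 : (2 : ℝ) ^ p * Real.exp ((∑ l, a l ^ 2) / 2) = ∏ l, (2 * Real.exp (a l ^ 2 / 2)) := by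
    rw [Finset.prod_mul_distrib, ← Real.exp_sum, Finset.sum_div]
    simp
  rw [h2]
  apply Finset.prod_le_prod
  · intro l _
    positivity
  · intro l _
    have := Real.cosh_le_exp_half_sq (a l)
    rw [Real.cosh_eq] at this
    simp
    linarith

theorem aux_tail {p : ℕ} (a : Fin p → ℝ) (V L : ℝ) (hV : ∑ l, a l ^ 2 ≤ V) (hL : 0 ≤ L) :
    ((Finset.univ.filter fun ω : Fin p → Bool =>
      2 * V * L < (∑ l, a l * signVec ω l) ^ 2).card : ℝ) ≤ 2 ^ p * (2 * Real.exp (-L)) := by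
  have hs0 : 0 ≤ ∑ l, a l ^ 2 := Finset.sum_nonneg fun l _ => sq_nonneg _
  rcases (hs0.trans hV).eq_or_lt with h0 | hVpos
  · have ha : ∀ l, a l = 0 := by
      intro l
      have h3 := Finset.single_le_sum (f := fun l => a l ^ 2) (fun l _ => sq_nonneg _)
        (Finset.mem_univ l)
      have h4 : a l ^ 2 ≤ 0 := by
        linarith
      exact pow_eq_zero_iff (two_ne_zero) |>.1 (le_antisymm h4 (sq_nonneg _))
    have : (Finset.univ.filter fun ω : Fin p → Bool =>
      2 * V * L < (∑ l, a l * signVec ω l) ^ 2) = ∅ := by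
      apply Finset.filter_false_of_mem
      intro ω _
      simp [ha, ← h0]
    rw [this]
    simp
    positivity
  · set t := Real.sqrt (2 * V * L) with ht
    have ht2 : t ^ 2 = 2 * V * L := Real.sq_sqrt (by positivity)
    have ht0 : 0 ≤ t := Real.sqrt_nonneg _
    set c := t / V with hc
    have hc0 : 0 ≤ c := by positivity
    have hct : c * t = 2 * L := by
      rw [hc]; field_simp; linarith
    have hcV : c ^ 2 * V = 2 * L := by
      rw [hc]; field_simp; linarith
    have key : ∀ c' : ℝ, c' ^ 2 = c ^ 2 →
        ∑ ω : Fin p → Bool, Real.exp (c' * ∑ l, a l * signVec ω l) ≤ 2 ^ p * Real.exp L := by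
      intro c' hc'
      have := aux_mgf fun l => c' * a l
      have e : ∀ ω : Fin p → Bool, c' * ∑ l, a l * signVec ω l
          = ∑ l, (c' * a l) * signVec ω l := by
        intro ω
        rw [Finset.mul_sum]
        exact Finset.sum_congr rfl fun l _ => by ring
      simp only [e]
      refine this.trans ?_
      gcongr
      simp only [mul_pow, ← Finset.mul_sum, hc']
      nlinarith [mul_le_mul_of_nonneg_left hV (sq_nonneg c)]
    have h5 : ((Finset.univ.filter fun ω : Fin p → Bool =>
        2 * V * L < (∑ l, a l * signVec ω l) ^ 2).card : ℝ) * Real.exp (2 * L) ≤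
        ∑ ω : Fin p → Bool, (Real.exp (c * ∑ l, a l * signVec ω l)
          + Real.exp ((-c) * ∑ l, a l * signVec ω l)) := by
      rw [← nsmul_eq_mul]
      refine le_trans (Finset.card_nsmul_le_sum _ _ _ ?_)
        (Finset.sum_le_sum_of_subset_of_nonneg (Finset.filter_subset _ _)
          fun _ _ _ => by positivity)
      intro ω hω
      simp only [Finset.mem_filter, Finset.mem_univ, true_and] at hω
      rw [← ht2] at hω
      have hlt : t < |∑ l, a l * signVec ω l| := by
        have := sq_lt_sq.1 hω
        rwa [abs_of_nonneg ht0] at this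
      rcases abs_cases (∑ l, a l * signVec ω l) with ⟨h, _⟩ | ⟨h, _⟩
      · rw [h] at hlt
        have : Real.exp (2 * L) ≤ Real.exp (c * ∑ l, a l * signVec ω l) := by
          apply Real.exp_le_exp.2
          rw [← hct]; gcongr
        have := Real.exp_pos ((-c) * ∑ l, a l * signVec ω l)
        linarith
      · rw [h] at hlt
        have : Real.exp (2 * L) ≤ Real.exp ((-c) * ∑ l, a l * signVec ω l) := by
          apply Real.exp_le_exp.2
          rw [← hct, neg_mul, ← mul_neg]; gcongr
        have := Real.exp_pos (c * ∑ l, a l * signVec ω l)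
        linarith
    rw [Finset.sum_add_distrib] at h5
    have h6 := key c rfl
    have h7 := key (-c) (by ring)
    have h8 : Real.exp L = Real.exp (-L) * Real.exp (2 * L) := by
      rw [← Real.exp_add]; congr 1; ring
    have h9 := Real.exp_pos (2 * L)
    refine le_of_mul_le_mul_right ?_ h9
    calc _ ≤ _ := h5
      _ ≤ 2 ^ p * Real.exp L + 2 ^ p * Real.exp L := add_le_add h6 h7
      _ = _ := by rw [h8]; ring

/-- simultaneous norm bounds after preconditioning and subsampling:
for data `x₁,…,x_n`, with `y_i = H D x_i` and `w_i` keeping the entries of `y_i` on a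
uniformly random `m`-element coordinate subset (independent of `D`, one subset per `i`),
with probability `≥ 1 − α` simultaneously for all `i`:
`‖w_i‖₂² ≤ (m/p)·(2/η)·log(2np/α)·‖x_i‖₂²`. -/
theorem stmt_4 (p n m : ℕ) (hp : 0 < p) (hn : 0 < n) (hm : m ≤ p)
    (x : Fin n → Fin p → ℝ) (η : ℝ) (hη : 0 < η)
    (H : Matrix (Fin p) (Fin p) ℝ)
    (hH : ∀ j l, |H j l| ≤ 1 / Real.sqrt (η * p))
    (α : ℝ) (hα0 : 0 < α) (hα1 : α < 1) :
    probOf {ω : (Fin p → Bool) × (Fin n → {S : Finset (Fin p) // S.card = m}) |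
        ∀ i, ∑ j, (if j ∈ (ω.2 i).1 then ((H * signMatrix ω.1) *ᵥ x i) j else 0) ^ 2 ≤
          ((m : ℝ) / p) * (2 / η) * Real.log (2 * n * p / α) * ∑ j, x i j ^ 2} ≥ 1 - α := by
  classical
  set L := Real.log (2 * n * p / α) with hLdef
  have hpR : (1 : ℝ) ≤ p := by exact_mod_cast hp
  have hnR : (1 : ℝ) ≤ n := by exact_mod_cast hn
  have hnp : (1 : ℝ) ≤ n * p := by nlinarith
  have hL : 0 ≤ L := by
    apply Real.log_nonneg
    rw [le_div_iff₀ hα0]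
    nlinarith
  have hexp : Real.exp (-L) = α / (2 * n * p) := by
    rw [Real.exp_neg, hLdef, Real.exp_log (by positivity), inv_div]
  have hy : ∀ (ω : Fin p → Bool) i j,
      ((H * signMatrix ω) *ᵥ x i) j = ∑ l, (H j l * x i l) * signVec ω l := by
    intro ω i j
    simp only [Matrix.mulVec, dotProduct, signMatrix, Matrix.mul_diagonal]
    exact Finset.sum_congr rfl fun l _ => by ring
  let V : Fin n → ℝ := fun i => (1 / (η * p)) * ∑ l, x i l ^ 2
  let B : Fin n × Fin p → Finset (Fin p → Bool) := fun q =>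
    Finset.univ.filter fun ω => 2 * V q.1 * L < (∑ l, (H q.2 l * x q.1 l) * signVec ω l) ^ 2
  have hB : ∀ q, ((B q).card : ℝ) ≤ 2 ^ p * (α / (n * p)) := by
    intro q
    have := aux_tail (fun l => H q.2 l * x q.1 l) (V q.1) L ?_ hL
    · rw [hexp] at this
      refine this.trans (le_of_eq ?_)
      field_simp
    · simp only [V, Finset.mul_sum, mul_pow]
      apply Finset.sum_le_sum
      intro l _
      gcongr
      have h1 := hH q.2 l
      rw [← sq_abs]
      calc |H q.2 l| ^ 2 ≤ (1 / Real.sqrt (η * p)) ^ 2 := by gcongr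
        _ = 1 / (η * p) := by rw [div_pow, Real.sq_sqrt (by positivity), one_pow]
  let Bad := Finset.univ.biUnion B
  have hBad : (Bad.card : ℝ) ≤ 2 ^ p * α := by
    calc (Bad.card : ℝ) ≤ ∑ q, ((B q).card : ℝ) := by exact_mod_cast Finset.card_biUnion_le
      _ ≤ ∑ _q : Fin n × Fin p, 2 ^ p * (α / (n * p)) := Finset.sum_le_sum fun q _ => hB q
      _ = 2 ^ p * α := by
        simp
        field_simp
  let S := Fin n → {S : Finset (Fin p) // S.card = m}
  have hS : 0 < Fintype.card S := by
    obtain ⟨s, -, hs⟩ := Finset.exists_subset_card_eq (s := (Finset.univ : Finset (Fin p)))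
      (n := m) (by simpa using hm)
    exact Fintype.card_pos_iff.2 ⟨fun _ => ⟨s, hs⟩⟩
  have hSR : (0 : ℝ) < Fintype.card S := by exact_mod_cast hS
  have hsub : (((Badᶜ) ×ˢ (Finset.univ : Finset S) : Finset ((Fin p → Bool) × S)) : Set _) ⊆
      {ω : (Fin p → Bool) × (Fin n → {S : Finset (Fin p) // S.card = m}) |
        ∀ i, ∑ j, (if j ∈ (ω.2 i).1 then ((H * signMatrix ω.1) *ᵥ x i) j else 0) ^ 2 ≤
          ((m : ℝ) / p) * (2 / η) * L * ∑ j, x i j ^ 2} := by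
    rintro ⟨ω, s⟩ h i
    simp only [Finset.coe_product, Set.mem_prod, Finset.mem_coe, Finset.mem_compl, Bad,
      Finset.mem_biUnion, Finset.mem_univ, true_and, and_true, not_exists, B,
      Finset.mem_filter, not_lt] at h
    simp only [ite_pow, ne_eq, OfNat.ofNat_ne_zero, not_false_eq_true, zero_pow]
    rw [← Finset.sum_filter]
    have hc : (Finset.univ.filter fun j => j ∈ (s i).1) = (s i).1 := by ext; simp
    rw [hc]
    have h1 := Finset.sum_le_card_nsmul (s i).1
      (fun j => ((H * signMatrix ω) *ᵥ x i) j ^ 2) (2 * V i * L)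
      (fun j _ => by
        have h2 := h (i, j)
        rw [← hy ω i j] at h2
        exact h2)
    refine h1.trans (le_of_eq ?_)
    rw [(s i).2, nsmul_eq_mul]
    simp only [V]
    field_simp
  unfold probOf
  have hcard := Set.ncard_le_ncard hsub (Set.toFinite _)
  rw [Set.ncard_coe_finset, Finset.card_product, Finset.card_compl, Finset.card_univ] at hcard
  have hle : Bad.card ≤ Fintype.card (Fin p → Bool) := Finset.card_le_univ _
  have hcR := (Nat.cast_le (α := ℝ)).2 hcard
  rw [Nat.cast_mul, Nat.cast_sub hle] at hcR
  rw [ge_iff_le, Fintype.card_prod, Nat.cast_mul]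
  have hO : (Fintype.card (Fin p → Bool) : ℝ) = 2 ^ p := by simp
  rw [hO] at hcR ⊢
  rw [le_div_iff₀ (by positivity)]
  refine le_trans ?_ hcR
  rw [← mul_assoc]
  refine mul_le_mul_of_nonneg_right ?_ hSR.le
  linarith
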